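/- (Theorem 1, deterministic form on the RF approximation event.) Suppose |κ̄(s, s')| ≤ 1 for all s, s', the uniform ε-approximation |φ_ζ(s)ᵀ φ_ζ(s') − κ̄(s, s')| < ε holds for all s, s' ∈ ℝ^d, σ_n² ≤ 1/2, and the Bellman residuals are bounded by B_e: |r_t − h_tᵀ θ̂_{t-1}| ≤ B_e, |r_t − v*(s_t) + γ v*(s_{t+1})| ≤ B_e, and |r_t − v̌*(s_t) + γ v̌*(s_{t+1})| ≤ B_e for t = 1, …, T. Then the OS-GPTD iterates satisfy Σ_{t=1}^T l_t(θ̂_{t-1}) − Σ_{t=1}^T l_t(v*) ≤ 2(1+γ) ε B_e C T + (1+ε) C²/(2σ_θ²) + 2D B_e² log((1+γ)² σ_θ² T/σ_n² + 1). -/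

import Mathlib

open Matrix Finset

/-- The random-feature map `φ_ζ : ℝ^d → ℝ^{2D}`, with `ℝ^{2D}` realized as
`Fin D × Bool → ℝ`. -/
noncomputable def rfMap (d D : ℕ) (ζ : Fin D → Fin d → ℝ) (s : Fin d → ℝ) :
    Fin D × Bool → ℝ :=
  fun p => (1 / Real.sqrt D) *
    (if p.2 then Real.sin (ζ p.1 ⬝ᵥ s) else Real.cos (ζ p.1 ⬝ᵥ s))

/-- The inverse posterior covariance of Bayesian linear regression with prior covariance `a • 1`,
noise variance `b` and regressors `h 1, …, h t`. -/
noncomputable def precisionMatrix {ι : Type*} [DecidableEq ι] (a b : ℝ) (h : ℕ → ι → ℝ) (t : ℕ) :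
    Matrix ι ι ℝ :=
  a⁻¹ • 1 + b⁻¹ • ∑ i ∈ range t, vecMulVec (h (i + 1)) (h (i + 1))

lemma precisionMatrix_succ {ι : Type*} [DecidableEq ι] (a b : ℝ) (h : ℕ → ι → ℝ) (t : ℕ) :
    precisionMatrix a b h (t + 1) =
      precisionMatrix a b h t + b⁻¹ • vecMulVec (h (t + 1)) (h (t + 1)) := by
  simp only [precisionMatrix, sum_range_succ, smul_add, add_assoc]

section Ridge

variable {ι : Type*} [Fintype ι] [DecidableEq ι]

lemma precisionMatrix_posDef {a b : ℝ} (ha : 0 < a) (hb : 0 < b) (h : ℕ → ι → ℝ) (t : ℕ) :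
    (precisionMatrix a b h t).PosDef := by
  refine (PosDef.one.smul (inv_pos.2 ha)).add_posSemidef (PosSemidef.smul ?_ (inv_pos.2 hb).le)
  refine posSemidef_sum _ fun i _ => ?_
  simpa using posSemidef_vecMulVec_self_star (h (i + 1))

lemma trace_precisionMatrix (a b : ℝ) (h : ℕ → ι → ℝ) (t : ℕ) :
    (precisionMatrix a b h t).trace =
      Fintype.card ι * a⁻¹ + b⁻¹ * ∑ i ∈ range t, h (i + 1) ⬝ᵥ h (i + 1) := by
  simp [precisionMatrix, trace_sum, trace_vecMulVec, mul_comm]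

/-- Rank-one update of an inverse (Sherman–Morrison). -/
lemma add_smul_vecMulVec_mul_sub {P S : Matrix ι ι ℝ} (hPS : P * S = 1) {b : ℝ} (hb : b ≠ 0)
    (u : ι → ℝ) (hq : u ⬝ᵥ S *ᵥ u + b ≠ 0) :
    (P + b⁻¹ • vecMulVec u u) *
      (S - (u ⬝ᵥ S *ᵥ u + b)⁻¹ • vecMulVec (S *ᵥ u) (u ᵥ* S)) = 1 := by
  have hc : b⁻¹ - (u ⬝ᵥ S *ᵥ u + b)⁻¹ - b⁻¹ * ((u ⬝ᵥ S *ᵥ u + b)⁻¹ * (u ⬝ᵥ S *ᵥ u)) = 0 := by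
    field_simp
    ring
  have key : (P + b⁻¹ • vecMulVec u u) *
      (S - (u ⬝ᵥ S *ᵥ u + b)⁻¹ • vecMulVec (S *ᵥ u) (u ᵥ* S)) =
      1 + (b⁻¹ - (u ⬝ᵥ S *ᵥ u + b)⁻¹ - b⁻¹ * ((u ⬝ᵥ S *ᵥ u + b)⁻¹ * (u ⬝ᵥ S *ᵥ u))) •
        vecMulVec u (u ᵥ* S) := by
    have hP : P * vecMulVec (S *ᵥ u) (u ᵥ* S) = vecMulVec u (u ᵥ* S) := by
      rw [mul_vecMulVec, mulVec_mulVec, hPS, one_mulVec]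
    have hu : vecMulVec u u * vecMulVec (S *ᵥ u) (u ᵥ* S) =
        (u ⬝ᵥ S *ᵥ u) • vecMulVec u (u ᵥ* S) := by
      rw [vecMulVec_mul_vecMulVec, vecMulVec_smul]
    simp only [add_mul, mul_sub, Matrix.mul_smul, Matrix.smul_mul, hPS, hP, hu,
      vecMulVec_mul u u S]
    module
  rw [key, hc, zero_smul, add_zero]

/-- The matrix determinant lemma for a symmetric rank-one update. -/
lemma det_add_smul_vecMulVec {P S : Matrix ι ι ℝ} (hPS : P * S = 1) (c : ℝ) (u : ι → ℝ) :
    (P + c • vecMulVec u u).det = P.det * (1 + c * (u ⬝ᵥ S *ᵥ u)) := by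
  have hfac : P + c • vecMulVec u u = P * (1 + vecMulVec (c • S *ᵥ u) u) := by
    rw [mul_add, mul_one, mul_vecMulVec, mulVec_smul, mulVec_mulVec, hPS, one_mulVec,
      smul_vecMulVec]
  rw [hfac, det_mul, vecMulVec_eq Unit, det_one_add_replicateCol_mul_replicateRow,
    dotProduct_smul, smul_eq_mul]

/-- A positive definite matrix whose trace is at most `n * a` has determinant at most `a ^ n`. -/
lemma log_det_le_of_trace_le {P : Matrix ι ι ℝ} (hP : P.PosDef) {a : ℝ} (ha : 0 < a)
    (htr : P.trace ≤ Fintype.card ι * a) :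
    Real.log P.det ≤ Fintype.card ι * Real.log a := by
  have hpos := hP.eigenvalues_pos
  have hdet : P.det = ∏ i, hP.isHermitian.eigenvalues i := by
    simpa using hP.isHermitian.det_eq_prod_eigenvalues
  have htrace : P.trace = ∑ i, hP.isHermitian.eigenvalues i := by
    simpa using hP.isHermitian.trace_eq_sum_eigenvalues
  rw [hdet, Real.log_prod fun i _ => (hpos i).ne']
  calc ∑ i, Real.log (hP.isHermitian.eigenvalues i)
      ≤ ∑ i, (Real.log a + (hP.isHermitian.eigenvalues i / a - 1)) := by
        refine sum_le_sum fun i _ => ?_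
        have := Real.log_le_sub_one_of_pos (div_pos (hpos i) ha)
        rw [Real.log_div (hpos i).ne' ha.ne'] at this
        linarith
    _ = Fintype.card ι * Real.log a + (P.trace / a - Fintype.card ι) := by
        rw [htrace, sum_add_distrib, sum_sub_distrib, sum_div]
        simp
    _ ≤ Fintype.card ι * Real.log a := by
        have := (div_le_iff₀ ha).2 htr
        linarith

/-- One step of recursive least squares, measured against a fixed comparator `u`. -/
lemma dotProduct_mulVec_rls_step {P S : Matrix ι ι ℝ} (hP : P.PosDef) (hPS : P * S = 1)
    {b : ℝ} (hb : b ≠ 0) (g θ u : ι → ℝ) (y : ℝ) (hq : g ⬝ᵥ S *ᵥ g + b ≠ 0) :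
    let θ' := θ + ((y - g ⬝ᵥ θ) / (g ⬝ᵥ S *ᵥ g + b)) • (S *ᵥ g)
    (u - θ') ⬝ᵥ (P + b⁻¹ • vecMulVec g g) *ᵥ (u - θ') =
      (u - θ) ⬝ᵥ P *ᵥ (u - θ) + (y - g ⬝ᵥ u) ^ 2 / b
        - (y - g ⬝ᵥ θ) ^ 2 / (g ⬝ᵥ S *ᵥ g + b) := by
  intro θ'
  have hk : P *ᵥ (S *ᵥ g) = g := by rw [mulVec_mulVec, hPS, one_mulVec]
  have hsymm : (S *ᵥ g) ᵥ* P = g := by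
    have hPT : Pᵀ = P := by simpa using hP.isHermitian.eq
    rw [← mulVec_transpose, hPT, hk]
  obtain ⟨w, rfl⟩ : ∃ w, u = θ + w := ⟨u - θ, by simp⟩
  have hw : θ + w - θ' = w - ((y - g ⬝ᵥ θ) / (g ⬝ᵥ S *ᵥ g + b)) • (S *ᵥ g) := by
    simp only [θ']
    abel
  have hcross : (S *ᵥ g) ⬝ᵥ P *ᵥ w = g ⬝ᵥ w := by rw [dotProduct_mulVec, hsymm]
  rw [hw, add_sub_cancel_left]
  simp only [add_mulVec, smul_mulVec, vecMulVec_mulVec, mulVec_sub, mulVec_smul, dotProduct_add,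
    dotProduct_sub, sub_dotProduct, dotProduct_smul, smul_dotProduct, hk, hcross, smul_eq_mul,
    op_smul_eq_smul]
  rw [dotProduct_comm w g, dotProduct_comm (S *ᵥ g) g]
  generalize g ⬝ᵥ S *ᵥ g = q at *
  field_simp
  ring

section Recursion

variable {a b : ℝ} {h : ℕ → ι → ℝ} {r : ℕ → ℝ} {θ : ℕ → ι → ℝ} {S : ℕ → Matrix ι ι ℝ}

lemma dotProduct_mulVec_nonneg_of_precisionMatrix_mul_eq_one (ha : 0 < a) (hb : 0 < b) {t : ℕ}
    {M : Matrix ι ι ℝ} (hM : precisionMatrix a b h t * M = 1) (u : ι → ℝ) :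
    0 ≤ u ⬝ᵥ M *ᵥ u := by
  have hpos : M.PosDef := by
    rw [← inv_eq_right_inv hM]
    exact (precisionMatrix_posDef ha hb h t).inv
  simpa using hpos.posSemidef.dotProduct_mulVec_nonneg u

lemma precisionMatrix_mul_eq_one (ha : 0 < a) (hb : 0 < b) (hS0 : S 0 = a • 1)
    (hS : ∀ t, S (t + 1) = S t - (h (t + 1) ⬝ᵥ S t *ᵥ h (t + 1) + b)⁻¹ •
      vecMulVec (S t *ᵥ h (t + 1)) (h (t + 1) ᵥ* S t)) (t : ℕ) :
    precisionMatrix a b h t * S t = 1 := by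
  induction t with
  | zero => simp [precisionMatrix, hS0, smul_smul, ha.ne']
  | succ t ih =>
    have hq := dotProduct_mulVec_nonneg_of_precisionMatrix_mul_eq_one ha hb ih (h (t + 1))
    rw [hS, precisionMatrix_succ]
    exact add_smul_vecMulVec_mul_sub ih hb.ne' _ (by positivity)

/-- Regret of recursive least squares against a fixed comparator `u`, in terms of the
log-determinant of the precision matrix. -/
theorem rls_regret_add_potential_le (ha : 0 < a) (hb : 0 < b) (hθ0 : θ 0 = 0) (hS0 : S 0 = a • 1)
    (hθ : ∀ t, θ (t + 1) = θ t + ((r (t + 1) - h (t + 1) ⬝ᵥ θ t) /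
      (h (t + 1) ⬝ᵥ S t *ᵥ h (t + 1) + b)) • (S t *ᵥ h (t + 1)))
    (hS : ∀ t, S (t + 1) = S t - (h (t + 1) ⬝ᵥ S t *ᵥ h (t + 1) + b)⁻¹ •
      vecMulVec (S t *ᵥ h (t + 1)) (h (t + 1) ᵥ* S t))
    {B : ℝ} (u : ι → ℝ) (T : ℕ) (hB : ∀ t < T, |r (t + 1) - h (t + 1) ⬝ᵥ θ t| ≤ B) :
    ∑ t ∈ range T, (r (t + 1) - h (t + 1) ⬝ᵥ θ t) ^ 2
        + b * ((u - θ T) ⬝ᵥ precisionMatrix a b h T *ᵥ (u - θ T)) ≤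
      ∑ t ∈ range T, (r (t + 1) - h (t + 1) ⬝ᵥ u) ^ 2 + b / a * (u ⬝ᵥ u)
        + B ^ 2 * (Real.log (precisionMatrix a b h T).det + Fintype.card ι * Real.log a) := by
  induction T with
  | zero =>
    have hdet : (precisionMatrix a b h 0).det = a⁻¹ ^ Fintype.card ι := by
      simp [precisionMatrix]
    rw [hdet, Real.log_pow, Real.log_inv]
    simp [precisionMatrix, hθ0, smul_mulVec, div_eq_mul_inv, mul_assoc]
  | succ T ih =>
    have ih := ih fun t ht => hB t (by omega)
    have hPS := precisionMatrix_mul_eq_one ha hb hS0 hS T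
    have hP := precisionMatrix_posDef ha hb h T
    have hq := dotProduct_mulVec_nonneg_of_precisionMatrix_mul_eq_one ha hb hPS (h (T + 1))
    have hstep := dotProduct_mulVec_rls_step hP hPS hb.ne' (h (T + 1)) (θ T) u (r (T + 1))
      (by positivity)
    simp only [← hθ, ← precisionMatrix_succ] at hstep
    have he := sq_le_sq' (abs_le.1 (hB T (by omega))).1 (abs_le.1 (hB T (by omega))).2
    rw [sum_range_succ, sum_range_succ, hstep, precisionMatrix_succ,
      det_add_smul_vecMulVec hPS, Real.log_mul hP.det_pos.ne' (by positivity)]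
    generalize h (T + 1) ⬝ᵥ S T *ᵥ h (T + 1) = q at *
    generalize (r (T + 1) - h (T + 1) ⬝ᵥ θ T) ^ 2 = e at *
    have hlog := Real.one_sub_inv_le_log_of_pos (x := 1 + b⁻¹ * q) (by positivity)
    have hfrac : 1 - (1 + b⁻¹ * q)⁻¹ = q / (q + b) := by
      field_simp
      ring
    have hmul : e * (q / (q + b)) ≤ B ^ 2 * Real.log (1 + b⁻¹ * q) :=
      mul_le_mul he (hfrac ▸ hlog) (by positivity) (by positivity)
    have hsplit : e - b * (e / (q + b)) = e * (q / (q + b)) := by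
      field_simp
      ring
    have hcancel : ∀ x : ℝ, b * (x / b) = x := fun x => mul_div_cancel₀ x hb.ne'
    simp only [mul_add, mul_sub, hcancel] at ih ⊢
    linarith

/-- Regret of recursive least squares with regressors of squared norm at most `L`. -/
theorem rls_regret_le [Nonempty ι] (ha : 0 < a) (hb : 0 < b) (hθ0 : θ 0 = 0) (hS0 : S 0 = a • 1)
    (hθ : ∀ t, θ (t + 1) = θ t + ((r (t + 1) - h (t + 1) ⬝ᵥ θ t) /
      (h (t + 1) ⬝ᵥ S t *ᵥ h (t + 1) + b)) • (S t *ᵥ h (t + 1)))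
    (hS : ∀ t, S (t + 1) = S t - (h (t + 1) ⬝ᵥ S t *ᵥ h (t + 1) + b)⁻¹ •
      vecMulVec (S t *ᵥ h (t + 1)) (h (t + 1) ᵥ* S t))
    {B L : ℝ} (hL : 0 ≤ L) (u : ι → ℝ) (T : ℕ)
    (hB : ∀ t < T, |r (t + 1) - h (t + 1) ⬝ᵥ θ t| ≤ B) (hh : ∀ t, h t ⬝ᵥ h t ≤ L) :
    ∑ t ∈ range T, (r (t + 1) - h (t + 1) ⬝ᵥ θ t) ^ 2 ≤
      ∑ t ∈ range T, (r (t + 1) - h (t + 1) ⬝ᵥ u) ^ 2 + b / a * (u ⬝ᵥ u)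
        + Fintype.card ι * B ^ 2 * Real.log (L * a * T / b + 1) := by
  have hregret := rls_regret_add_potential_le ha hb hθ0 hS0 hθ hS u T hB
  have hP := precisionMatrix_posDef ha hb h T
  have hnonneg : 0 ≤ (u - θ T) ⬝ᵥ precisionMatrix a b h T *ᵥ (u - θ T) := by
    simpa using hP.posSemidef.dotProduct_mulVec_nonneg (u - θ T)
  have hcard : (1 : ℝ) ≤ Fintype.card ι := by exact_mod_cast Fintype.card_pos
  have hsum : ∑ i ∈ range T, h (i + 1) ⬝ᵥ h (i + 1) ≤ T * L := by
    simpa using sum_le_card_nsmul (range T) _ L fun i _ => hh (i + 1)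
  have hc : 0 < a⁻¹ + b⁻¹ * (T * L) := by positivity
  have hdet := log_det_le_of_trace_le hP hc <| by
    rw [trace_precisionMatrix, mul_add]
    refine add_le_add le_rfl ?_
    calc b⁻¹ * ∑ i ∈ range T, h (i + 1) ⬝ᵥ h (i + 1) ≤ b⁻¹ * (T * L) := by gcongr
      _ ≤ Fintype.card ι * (b⁻¹ * (T * L)) := le_mul_of_one_le_left (by positivity) hcard
  have hlog : Real.log (L * a * T / b + 1) = Real.log (a⁻¹ + b⁻¹ * (T * L)) + Real.log a := by
    rw [← Real.log_mul hc.ne' ha.ne']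
    congr 1
    field_simp
    ring
  have hpot : B ^ 2 * (Real.log (precisionMatrix a b h T).det + Fintype.card ι * Real.log a) ≤
      Fintype.card ι * B ^ 2 * Real.log (L * a * T / b + 1) := by
    rw [hlog, mul_comm (Fintype.card ι : ℝ) (B ^ 2), mul_assoc, mul_add (Fintype.card ι : ℝ)]
    exact mul_le_mul_of_nonneg_left (add_le_add hdet le_rfl) (sq_nonneg B)
  have := mul_nonneg hb.le hnonneg
  linarith

end Recursion

end Ridge

lemma rfMap_dotProduct_self {d D : ℕ} (hD : 1 ≤ D) (ζ : Fin D → Fin d → ℝ) (x : Fin d → ℝ) :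
    rfMap d D ζ x ⬝ᵥ rfMap d D ζ x = 1 := by
  have hD' : (D : ℝ) ≠ 0 := by positivity
  have hsqrt : (1 / √(D : ℝ)) * (1 / √(D : ℝ)) = 1 / D := by
    rw [div_mul_div_comm, one_mul, Real.mul_self_sqrt (Nat.cast_nonneg D)]
  have hterm : ∀ i : Fin D, ∑ c : Bool, rfMap d D ζ x (i, c) * rfMap d D ζ x (i, c) = 1 / D := by
    intro i
    simp only [rfMap, Fintype.sum_bool, if_true, Bool.false_eq_true, if_false]
    rw [mul_mul_mul_comm, mul_mul_mul_comm (1 / √(D : ℝ)) (Real.cos _), hsqrt, ← mul_add, ← sq, ← sq,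
      Real.sin_sq_add_cos_sq, mul_one]
  rw [dotProduct, Fintype.sum_prod_type, sum_congr rfl fun i _ => hterm i]
  simp [hD']

lemma dotProduct_sq_le {ι : Type*} [Fintype ι] (x y : ι → ℝ) :
    (x ⬝ᵥ y) ^ 2 ≤ (x ⬝ᵥ x) * (y ⬝ᵥ y) := by
  simpa only [dotProduct, sq] using sum_mul_sq_le_sq_mul_sq univ x y

lemma abs_rfMap_dotProduct_le {d D : ℕ} (hD : 1 ≤ D) (ζ : Fin D → Fin d → ℝ)
    (x y : Fin d → ℝ) : |rfMap d D ζ x ⬝ᵥ rfMap d D ζ y| ≤ 1 := by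
  have := dotProduct_sq_le (rfMap d D ζ x) (rfMap d D ζ y)
  rw [rfMap_dotProduct_self hD, rfMap_dotProduct_self hD, mul_one] at this
  exact (sq_le_one_iff_abs_le_one _).1 this

lemma rfMap_sub_smul_dotProduct_self_le {d D : ℕ} (hD : 1 ≤ D) (ζ : Fin D → Fin d → ℝ)
    (x y : Fin d → ℝ) {γ : ℝ} (hγ : 0 ≤ γ) :
    (rfMap d D ζ x - γ • rfMap d D ζ y) ⬝ᵥ (rfMap d D ζ x - γ • rfMap d D ζ y) ≤
      (1 + γ) ^ 2 := by
  have hxy := (abs_le.1 (abs_rfMap_dotProduct_le hD ζ x y)).1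
  simp only [dotProduct_sub, sub_dotProduct, dotProduct_smul, smul_dotProduct, smul_eq_mul,
    rfMap_dotProduct_self hD, dotProduct_comm (rfMap d D ζ y) (rfMap d D ζ x)]
  nlinarith

lemma sum_smul_rfMap_dotProduct_self_le {d D : ℕ} (hD : 1 ≤ D) (ζ : Fin D → Fin d → ℝ)
    {τ : Type*} (I : Finset τ) (α : τ → ℝ) (s : τ → Fin d → ℝ) :
    (∑ t ∈ I, α t • rfMap d D ζ (s t)) ⬝ᵥ (∑ t ∈ I, α t • rfMap d D ζ (s t)) ≤
      (∑ t ∈ I, |α t|) ^ 2 := by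
  rw [sum_dotProduct, sq, sum_mul]
  refine sum_le_sum fun i _ => ?_
  rw [dotProduct_sum, mul_sum]
  refine sum_le_sum fun j _ => ?_
  rw [smul_dotProduct, dotProduct_smul, smul_eq_mul, smul_eq_mul, ← mul_assoc]
  calc _ ≤ |α i * α j * (rfMap d D ζ (s i) ⬝ᵥ rfMap d D ζ (s j))| := le_abs_self _
    _ = |α i| * |α j| * |rfMap d D ζ (s i) ⬝ᵥ rfMap d D ζ (s j)| := by rw [abs_mul, abs_mul]
    _ ≤ |α i| * |α j| :=
      mul_le_of_le_one_right (by positivity) (abs_rfMap_dotProduct_le hD ζ _ _)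

lemma sum_Icc_one_eq_sum_range (f : ℕ → ℝ) (T : ℕ) :
    ∑ t ∈ Icc 1 T, f t = ∑ t ∈ range T, f (t + 1) := by
  induction T with
  | zero => simp
  | succ T ih => rw [sum_Icc_succ_top (by omega), sum_range_succ, ih]

lemma sq_sub_sq_le_of_abs_le {x y B δ : ℝ} (hx : |x| ≤ B) (hy : |y| ≤ B) (hxy : |x - y| ≤ δ) :
    x ^ 2 - y ^ 2 ≤ 2 * B * δ := by
  have hsum : |x + y| ≤ 2 * B := (abs_add_le x y).trans (by linarith)
  calc x ^ 2 - y ^ 2 = (x + y) * (x - y) := by ring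
    _ ≤ |x + y| * |x - y| := by rw [← abs_mul]; exact le_abs_self _
    _ ≤ 2 * B * δ := mul_le_mul hsum hxy (abs_nonneg _) ((abs_nonneg _).trans hsum)

/-- **Theorem 1, deterministic form on the RF approximation event.**
Under a bounded kernel, the uniform ε-approximation of the kernel by the random
features, `σ_n² ≤ 1/2`, and Bellman residuals bounded by `B_e`, the OS-GPTD iterates
satisfy
`∑_{t=1}^T l_t(θ̂_{t-1}) − ∑_{t=1}^T l_t(v*)
  ≤ 2(1+γ) ε B_e C T + (1+ε) C²/(2σ_θ²) + 2D B_e² log((1+γ)² σ_θ² T/σ_n² + 1)`. -/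
theorem osgptd_theorem1_regret_bound
    (d D T : ℕ) (hd : 1 ≤ d) (hD : 1 ≤ D) (hT : 1 ≤ T)
    (ζ : Fin D → Fin d → ℝ)
    (s : ℕ → Fin d → ℝ) (α : ℕ → ℝ) (r : ℕ → ℝ)
    (σθ σn ε γ Be : ℝ) (hσθ : 0 < σθ) (hσn : 0 < σn) (hε : 0 < ε)
    (hγ0 : 0 ≤ γ) (hγ1 : γ < 1) (hBe : 0 < Be) (hσn2 : σn ^ 2 ≤ 1 / 2)
    (κ : (Fin d → ℝ) → (Fin d → ℝ) → ℝ)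
    (hκbdd : ∀ x y : Fin d → ℝ, |κ x y| ≤ 1)
    (happrox : ∀ x y : Fin d → ℝ, |rfMap d D ζ x ⬝ᵥ rfMap d D ζ y - κ x y| < ε)
    (vstar : (Fin d → ℝ) → ℝ)
    (hvstar : ∀ x, vstar x = σθ ^ 2 * ∑ t ∈ Finset.Icc 1 T, α t * κ x (s t))
    (θstar : Fin D × Bool → ℝ)
    (hθstar : θstar = σθ ^ 2 • ∑ t ∈ Finset.Icc 1 T, α t • rfMap d D ζ (s t))
    (vcheck : (Fin d → ℝ) → ℝ)
    (hvcheck : ∀ x, vcheck x = rfMap d D ζ x ⬝ᵥ θstar)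
    (C : ℝ) (hC : C = σθ ^ 2 * ∑ t ∈ Finset.Icc 1 T, |α t|)
    -- the RF-based observation vectors h_t = φ_ζ(s_t) − γ φ_ζ(s_{t+1})
    (hvec : ℕ → Fin D × Bool → ℝ)
    (hhvec : ∀ t : ℕ, hvec t = rfMap d D ζ (s t) - γ • rfMap d D ζ (s (t + 1)))
    -- the OS-GPTD recursion (with n = 2D)
    (θ : ℕ → Fin D × Bool → ℝ) (S : ℕ → Matrix (Fin D × Bool) (Fin D × Bool) ℝ)
    (hθ0 : θ 0 = 0)
    (hS0 : S 0 = σθ ^ 2 • (1 : Matrix (Fin D × Bool) (Fin D × Bool) ℝ))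
    (hθrec : ∀ t : ℕ, θ (t + 1) = θ t +
      ((r (t + 1) - hvec (t + 1) ⬝ᵥ θ t) /
          (hvec (t + 1) ⬝ᵥ S t *ᵥ hvec (t + 1) + σn ^ 2)) •
        (S t *ᵥ hvec (t + 1)))
    (hSrec : ∀ t : ℕ, S (t + 1) = S t -
      (hvec (t + 1) ⬝ᵥ S t *ᵥ hvec (t + 1) + σn ^ 2)⁻¹ •
        vecMulVec (S t *ᵥ hvec (t + 1)) (hvec (t + 1) ᵥ* S t))
    -- bounded Bellman residuals
    (hres : ∀ t ∈ Finset.Icc 1 T, |r t - hvec t ⬝ᵥ θ (t - 1)| ≤ Be)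
    (hresV : ∀ t ∈ Finset.Icc 1 T, |r t - vstar (s t) + γ * vstar (s (t + 1))| ≤ Be)
    (hresVc : ∀ t ∈ Finset.Icc 1 T,
      |r t - vcheck (s t) + γ * vcheck (s (t + 1))| ≤ Be) :
    ∑ t ∈ Finset.Icc 1 T, (r t - hvec t ⬝ᵥ θ (t - 1)) ^ 2
      - ∑ t ∈ Finset.Icc 1 T, (r t - vstar (s t) + γ * vstar (s (t + 1))) ^ 2 ≤
    2 * (1 + γ) * ε * Be * C * T + (1 + ε) * C ^ 2 / (2 * σθ ^ 2)
      + 2 * D * Be ^ 2 * Real.log ((1 + γ) ^ 2 * σθ ^ 2 * T / σn ^ 2 + 1) := by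
  have : Nonempty (Fin D × Bool) := ⟨(⟨0, hD⟩, true)⟩
  have ha : 0 < σθ ^ 2 := by positivity
  have hb : 0 < σn ^ 2 := by positivity
  have hregret := rls_regret_le (L := (1 + γ) ^ 2) (B := Be) ha hb hθ0 hS0 hθrec hSrec
    (by positivity) θstar T
    (fun t ht => by simpa using hres (t + 1) (mem_Icc.2 ⟨by omega, by omega⟩))
    (fun t => hhvec t ▸ rfMap_sub_smul_dotProduct_self_le hD ζ _ _ hγ0)
  have hcard : (Fintype.card (Fin D × Bool) : ℝ) = 2 * D := by simp [mul_comm]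
  have hnorm : θstar ⬝ᵥ θstar ≤ C ^ 2 := by
    rw [hθstar, hC, smul_dotProduct, dotProduct_smul, smul_eq_mul, smul_eq_mul, ← mul_assoc,
      ← sq, mul_pow]
    gcongr
    exact sum_smul_rfMap_dotProduct_self_le hD ζ _ α s
  have hreg : σn ^ 2 / σθ ^ 2 * (θstar ⬝ᵥ θstar) ≤ (1 + ε) * C ^ 2 / (2 * σθ ^ 2) := by
    have hnonneg : 0 ≤ θstar ⬝ᵥ θstar := by simpa using dotProduct_star_self_nonneg θstar
    calc σn ^ 2 / σθ ^ 2 * (θstar ⬝ᵥ θstar) ≤ (1 / 2) / σθ ^ 2 * C ^ 2 := by gcongr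
      _ = 1 * C ^ 2 / (2 * σθ ^ 2) := by field_simp
      _ ≤ (1 + ε) * C ^ 2 / (2 * σθ ^ 2) := by gcongr; linarith
  have hclose : ∀ x, |vcheck x - vstar x| ≤ ε * C := by
    intro x
    have hdiff : vcheck x - vstar x = σθ ^ 2 * ∑ t ∈ Icc 1 T,
        α t * (rfMap d D ζ x ⬝ᵥ rfMap d D ζ (s t) - κ x (s t)) := by
      rw [hvcheck, hvstar, hθstar, dotProduct_smul, dotProduct_sum, smul_eq_mul, ← mul_sub,
        ← sum_sub_distrib]
      simp only [dotProduct_smul, smul_eq_mul, mul_sub]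
    rw [hdiff, hC, abs_mul, abs_of_pos ha, mul_left_comm, mul_sum]
    gcongr
    refine (abs_sum_le_sum_abs _ _).trans (sum_le_sum fun t _ => ?_)
    rw [abs_mul, mul_comm ε]
    gcongr
    exact (happrox x (s t)).le
  have hresidual : ∀ t, r t - hvec t ⬝ᵥ θstar = r t - vcheck (s t) + γ * vcheck (s (t + 1)) := by
    intro t
    rw [hhvec, hvcheck, hvcheck, sub_dotProduct, smul_dotProduct, smul_eq_mul]
    ring
  have hcompare : ∑ t ∈ Icc 1 T, (r t - hvec t ⬝ᵥ θstar) ^ 2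
      - ∑ t ∈ Icc 1 T, (r t - vstar (s t) + γ * vstar (s (t + 1))) ^ 2 ≤
      2 * (1 + γ) * ε * Be * C * T := by
    rw [← sum_sub_distrib]
    calc _ ≤ ∑ t ∈ Icc 1 T, 2 * Be * ((1 + γ) * (ε * C)) := by
          refine sum_le_sum fun t ht => ?_
          rw [hresidual]
          refine sq_sub_sq_le_of_abs_le (hresVc t ht) (hresV t ht) ?_
          have h₁ := abs_le.1 (hclose (s t))
          have h₂ := abs_le.1 (hclose (s (t + 1)))
          rw [abs_le]
          constructor <;> nlinarith
      _ = 2 * (1 + γ) * ε * Be * C * T := by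
          rw [sum_const, Nat.card_Icc, Nat.add_sub_cancel, nsmul_eq_mul]
          ring
  rw [hcard] at hregret
  rw [sum_Icc_one_eq_sum_range fun t => (r t - hvec t ⬝ᵥ θstar) ^ 2] at hcompare
  rw [sum_Icc_one_eq_sum_range fun t => (r t - hvec t ⬝ᵥ θ (t - 1)) ^ 2]
  simp only [Nat.add_sub_cancel]
  linarith
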